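/- Every convex hexagon contains a convex quadrilateral whose vertices are four of the hexagon's vertices and whose area is at least 2/3 of the area of the hexagon. -/

import Mathlib

open MeasureTheory

/-- The area of a planar point set: the Lebesgue measure of its convex hull. -/
noncomputable def area (S : Set (ℝ × ℝ)) : ℝ :=
  (volume (convexHull ℝ S)).toReal

/-- Points in strictly convex position, affinely spanning the plane. -/
def StrictConvexPos {n : ℕ} (p : Fin n → ℝ × ℝ) : Prop :=
  (∀ i : Fin n, p i ∉ convexHull ℝ (p '' {j | j ≠ i})) ∧
    affineSpan ℝ (Set.range p) = ⊤

/-- Twice the signed area of the triangle `a b c`. -/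
def cross (a b c : ℝ × ℝ) : ℝ :=
  (b.1 - a.1) * (c.2 - a.2) - (b.2 - a.2) * (c.1 - a.1)

/-- The vertices are listed in counterclockwise order around a strictly convex polygon. -/
def IsCounterclockwise {n : ℕ} (q : Fin n → ℝ × ℝ) : Prop :=
  ∀ ⦃i j k : Fin n⦄, i < j → j < k → 0 < cross (q i) (q j) (q k)

lemma cross_rotate (a b c : ℝ × ℝ) : cross b c a = cross a b c := by
  unfold cross; ring

lemma cross_swap (a b c : ℝ × ℝ) : cross a c b = -cross a b c := by
  unfold cross; ring

lemma mem_convexHull_triangle {a b c z : ℝ × ℝ} (h : 0 < cross a b c)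
    (hab : 0 ≤ cross a b z) (hbc : 0 ≤ cross b c z) (hca : 0 ≤ cross c a z) :
    z ∈ convexHull ℝ {a, b, c} := by
  have hsum : cross b c z / cross a b c + (cross c a z / cross a b c + cross a b z / cross a b c)
      = 1 := by
    rw [← add_div, ← add_div, div_eq_one_iff_eq h.ne']
    unfold cross; ring
  have hmem := (convex_convexHull ℝ {a, b, c}).sum_mem (t := Finset.univ)
    (w := ![cross b c z / cross a b c, cross c a z / cross a b c, cross a b z / cross a b c])
    (z := ![a, b, c])
    (by intro i _; fin_cases i <;> simp <;> positivity)
    (by rw [Fin.sum_univ_three]; simpa [add_assoc] using hsum)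
    (by intro i _; apply subset_convexHull; fin_cases i <;> simp)
  convert hmem using 1
  rw [Fin.sum_univ_three]
  ext
  · simp
    field_simp
    unfold cross; ring
  · simp
    field_simp
    unfold cross; ring

lemma convex_cross_nonneg (a b : ℝ × ℝ) : Convex ℝ {z | 0 ≤ cross a b z} := by
  intro x hx y hy s t hs ht hst
  simp only [Set.mem_ofPred_eq] at *
  have : cross a b (s • x + t • y) = s * cross a b x + t * cross a b y := by
    obtain rfl : s = 1 - t := by linarith
    simp [cross]; ring
  rw [this]; positivity

/-- If the main diagonals `a d` and `b e` meet in `x`, on the side of `c f` containing `d`, `e`,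
and any two ears at distance two have total area more than a third of the hexagon, then `x`
is nearer to `a` than to `d` and nearer to `b` than to `e`. -/
lemma diagonal_param_lt_half {a b c d e f x : ℝ × ℝ} {s t S : ℝ}
    (hS : S = cross a b c + cross a c d + cross a d e + cross a e f)
    (hs0 : 0 ≤ s) (hs1 : s ≤ 1) (ht0 : 0 ≤ t) (ht1 : t ≤ 1)
    (hxs : x = a + s • (d - a)) (hxt : x = b + t • (e - b))
    (hx : cross c f x ≤ 0)
    (hbce : 0 < cross b c e)
    (hadf : 0 < cross a d f) (hbef : 0 < cross b e f)
    (hade : 0 < cross a d e) (habd : 0 < cross a b d)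
    (h₀ : S < 3 * (cross f a b + cross b c d)) (h₁ : S < 3 * (cross a b c + cross c d e))
    (h₂ : S < 3 * (cross b c d + cross d e f)) (h₃ : S < 3 * (cross c d e + cross e f a))
    (h₄ : S < 3 * (cross d e f + cross f a b)) (h₅ : S < 3 * (cross e f a + cross a b c)) :
    s < 1 / 2 ∧ t < 1 / 2 := by
  have hx1 : x.1 = a.1 + s * (d.1 - a.1) := by simp [hxs]
  have hx2 : x.2 = a.2 + s * (d.2 - a.2) := by simp [hxs]
  have hy1 : x.1 = b.1 + t * (e.1 - b.1) := by simp [hxt]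
  have hy2 : x.2 = b.2 + t * (e.2 - b.2) := by simp [hxt]
  have e₁ : cross b c x + cross e f x
      = (1 - s) * (cross a b c + cross e f a) + s * (cross b c d + cross d e f) := by
    unfold cross; rw [hx1, hx2]; ring
  have e₂ : cross c d x + cross f a x
      = (1 - t) * (cross b c d + cross f a b) + t * (cross c d e + cross e f a) := by
    unfold cross; rw [hy1, hy2]; ring
  have k₁ : S ≤ 3 * (cross b c x + cross e f x) := by
    rw [e₁]
    nlinarith [mul_nonneg (sub_nonneg.2 hs1) (sub_nonneg.2 h₅.le),
      mul_nonneg hs0 (sub_nonneg.2 h₂.le)]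
  have k₂ : S ≤ 3 * (cross c d x + cross f a x) := by
    rw [e₂]
    nlinarith [mul_nonneg (sub_nonneg.2 ht1) (sub_nonneg.2 h₀.le),
      mul_nonneg ht0 (sub_nonneg.2 h₃.le)]
  have v1 : b.1 - a.1 + e.1 - d.1 = -(1 - 2 * s) * (d.1 - a.1) + (1 - 2 * t) * (e.1 - b.1) := by
    linear_combination 2 * hx1 - 2 * hy1
  have v2 : b.2 - a.2 + e.2 - d.2 = -(1 - 2 * s) * (d.2 - a.2) + (1 - 2 * t) * (e.2 - b.2) := by
    linear_combination 2 * hx2 - 2 * hy2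
  have e₃ : cross b c x + cross e f x + cross c d x + cross f a x + cross a b c + cross c d e
      = S + ((1 - 2 * s) * cross a c d - (1 - 2 * t) * cross b c e) := by
    have : cross b c x + cross e f x + cross c d x + cross f a x + cross a b c + cross c d e
      = S + ((b.1 - a.1 + e.1 - d.1) * (c.2 - x.2) - (b.2 - a.2 + e.2 - d.2) * (c.1 - x.1)) := by
      rw [hS]; unfold cross; ring
    rw [this, v1, v2]
    have i₁ : (d.1 - a.1) * (c.2 - x.2) - (d.2 - a.2) * (c.1 - x.1) = - cross a c d := by
      unfold cross; rw [hx1, hx2]; ring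
    have i₂ : (e.1 - b.1) * (c.2 - x.2) - (e.2 - b.2) * (c.1 - x.1) = - cross b c e := by
      unfold cross; rw [hy1, hy2]; ring
    linear_combination -(1 - 2 * s) * i₁ + (1 - 2 * t) * i₂
  have e₄ : cross b c x + cross e f x + cross c d x + cross f a x + cross f a b + cross d e f
      = S + (-(1 - 2 * s) * cross a d f + (1 - 2 * t) * cross b e f) := by
    have : cross b c x + cross e f x + cross c d x + cross f a x + cross f a b + cross d e f
      = S + ((b.1 - a.1 + e.1 - d.1) * (f.2 - x.2) - (b.2 - a.2 + e.2 - d.2) * (f.1 - x.1)) := by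
      rw [hS]; unfold cross; ring
    rw [this, v1, v2]
    have i₁ : (d.1 - a.1) * (f.2 - x.2) - (d.2 - a.2) * (f.1 - x.1) = cross a d f := by
      unfold cross; rw [hx1, hx2]; ring
    have i₂ : (e.1 - b.1) * (f.2 - x.2) - (e.2 - b.2) * (f.1 - x.1) = cross b e f := by
      unfold cross; rw [hy1, hy2]; ring
    linear_combination -(1 - 2 * s) * i₁ + (1 - 2 * t) * i₂
  have p₁ : 0 < (1 - 2 * s) * cross a c d - (1 - 2 * t) * cross b c e := by linarith
  have p₂ : 0 < -(1 - 2 * s) * cross a d f + (1 - 2 * t) * cross b e f := by linarith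
  have hside : cross a d f * cross b c e ≤ cross a c d * cross b e f := by
    have : (cross a d e + cross a b d) * cross c f x
        = cross a d f * cross b c e - cross a c d * cross b e f := by
      have j₁ : cross a d f = (d.1 - a.1) * (f.2 - x.2) - (d.2 - a.2) * (f.1 - x.1) := by
        unfold cross; rw [hx1, hx2]; ring
      have j₂ : cross a c d = -((d.1 - a.1) * (c.2 - x.2) - (d.2 - a.2) * (c.1 - x.1)) := by
        unfold cross; rw [hx1, hx2]; ring
      have j₃ : cross b e f = (e.1 - b.1) * (f.2 - x.2) - (e.2 - b.2) * (f.1 - x.1) := by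
        unfold cross; rw [hy1, hy2]; ring
      have j₄ : cross b c e = -((e.1 - b.1) * (c.2 - x.2) - (e.2 - b.2) * (c.1 - x.1)) := by
        unfold cross; rw [hy1, hy2]; ring
      rw [j₁, j₂, j₃, j₄]; unfold cross; ring
    have := mul_nonpos_of_nonneg_of_nonpos (add_pos hade habd).le hx
    linarith
  have hG : 0 < 1 - 2 * s := by
    have hmul : 0 < (1 - 2 * s) * (cross a c d * cross b e f - cross a d f * cross b c e) := by
      linear_combination mul_pos p₁ hbef + mul_pos p₂ hbce
    by_contra! hcon
    exact hmul.not_ge (mul_nonpos_of_nonpos_of_nonneg hcon (sub_nonneg.2 hside))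
  have hH : 0 < 1 - 2 * t := by
    have hmul : 0 < (1 - 2 * t) * cross b e f := by linarith [mul_pos hG hadf]
    exact pos_of_mul_pos_left hmul hbef.le
  constructor <;> linarith

/-- The diagonals `a d` and `b e` of the convex quadrilateral `a b d e` cross. -/
lemma exists_diagonal_inter {a b d e : ℝ × ℝ} (habd : 0 < cross a b d) (habe : 0 < cross a b e)
    (hade : 0 < cross a d e) (hbde : 0 < cross b d e) :
    ∃ s t : ℝ, 0 ≤ s ∧ s ≤ 1 ∧ 0 ≤ t ∧ t ≤ 1 ∧ a + s • (d - a) = b + t • (e - b) := by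
  have hD : 0 < cross a b e + cross b d e := by linarith
  have hD' : cross a b d + cross a d e = cross a b e + cross b d e := by unfold cross; ring
  refine ⟨cross a b e / (cross a b e + cross b d e), cross a b d / (cross a b e + cross b d e),
    by positivity, (div_le_one hD).2 (by linarith), by positivity,
    (div_le_one hD).2 (by linarith), ?_⟩
  ext
  · simp only [Prod.fst_add, Prod.smul_fst, Prod.fst_sub, smul_eq_mul]
    field_simp
    unfold cross; ring
  · simp only [Prod.snd_add, Prod.smul_snd, Prod.snd_sub, smul_eq_mul]
    field_simp
    unfold cross; ring

/-- Two of the crossing points of the main diagonals give contradictory bounds on the diagonal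
`b e`. -/
lemma false_of_large_ears_of_side {q : Fin 6 → ℝ × ℝ} (hq : IsCounterclockwise q)
    {a b c d e f x : ℝ × ℝ} (ha : a = q 0) (hb : b = q 1) (hc : c = q 2) (hd : d = q 3)
    (he : e = q 4) (hf : f = q 5) {s t S : ℝ}
    (hS : S = cross a b c + cross a c d + cross a d e + cross a e f)
    (hs0 : 0 ≤ s) (hs1 : s ≤ 1) (ht0 : 0 ≤ t) (ht1 : t ≤ 1)
    (hxs : x = a + s • (d - a)) (hxt : x = b + t • (e - b)) (hx : cross c f x ≤ 0)
    (h₀ : S < 3 * (cross f a b + cross b c d)) (h₁ : S < 3 * (cross a b c + cross c d e))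
    (h₂ : S < 3 * (cross b c d + cross d e f)) (h₃ : S < 3 * (cross c d e + cross e f a))
    (h₄ : S < 3 * (cross d e f + cross f a b)) (h₅ : S < 3 * (cross e f a + cross a b c)) :
    False := by
  have pos (i j k : Fin 6) (hij : i < j := by decide) (hjk : j < k := by decide) :
      0 < cross (q i) (q j) (q k) := hq hij hjk
  have habd : 0 < cross a b d := by subst ha hb hd; exact pos 0 1 3
  have hacf : 0 < cross a c f := by subst ha hc hf; exact pos 0 2 5
  have hade : 0 < cross a d e := by subst ha hd he; exact pos 0 3 4
  have hadf : 0 < cross a d f := by subst ha hd hf; exact pos 0 3 5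
  have hbce : 0 < cross b c e := by subst hb hc he; exact pos 1 2 4
  have hbcf : 0 < cross b c f := by subst hb hc hf; exact pos 1 2 5
  have hbde : 0 < cross b d e := by subst hb hd he; exact pos 1 3 4
  have hbef : 0 < cross b e f := by subst hb he hf; exact pos 1 4 5
  have hcdf : 0 < cross c d f := by subst hc hd hf; exact pos 2 3 5
  have hcef : 0 < cross c e f := by subst hc he hf; exact pos 2 4 5
  have ht := (diagonal_param_lt_half hS hs0 hs1 ht0 ht1 hxs hxt hx hbce hadf hbef hade habd
    h₀ h₁ h₂ h₃ h₄ h₅).2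
  obtain ⟨t', r, ht'0, ht'1, hr0, hr1, hy⟩ := exists_diagonal_inter hbce hbcf hbef hcef
  have hle : t' ≤ t := by
    have k₁ : cross c f (b + t' • (e - b)) = 0 := by
      rw [hy]; simp [cross]; ring
    have k₂ : cross c f x - cross c f (b + t' • (e - b))
        = -(t - t') * (cross b c f + cross c e f) := by
      rw [hxt]; simp [cross]; ring
    by_contra! hlt
    nlinarith [mul_pos (sub_pos.2 hlt) (add_pos hbcf hcef)]
  have hside : cross a d (b + t' • (e - b)) ≤ 0 := by
    have k₁ : cross a d x = 0 := by
      rw [hxs]; simp [cross]; ring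
    have k₂ : cross a d x - cross a d (b + t' • (e - b))
        = (t - t') * (cross a b d + cross a d e) := by
      rw [hxt]; simp [cross]; ring
    nlinarith [mul_nonneg (sub_nonneg.2 hle) (add_pos habd hade).le]
  have hS' : S = cross e f a + cross e a b + cross e b c + cross e c d := by
    rw [hS]; unfold cross; ring
  have := (diagonal_param_lt_half (a := e) (b := f) (c := a) (d := b) (e := c) (f := d)
    (x := b + t' • (e - b)) (s := 1 - t') (t := 1 - r) hS' (by linarith) (by linarith)
    (by linarith) (by linarith) (by module) (by rw [hy]; module) hside
    (cross_rotate f a c ▸ hacf) (cross_rotate e b d ▸ hbde)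
    (cross_rotate f c d ▸ hcdf) (cross_rotate e b c ▸ hbce) (cross_rotate b e f ▸ hbef)
    h₄ h₅ h₀ h₁ h₂ h₃).1
  linarith

lemma IsCounterclockwise.rotate {q : Fin 6 → ℝ × ℝ} (hq : IsCounterclockwise q) (r : Fin 6) :
    IsCounterclockwise fun i => q (i + r) := by
  have key : ∀ r i j k : Fin 6, i < j → j < k → (i + r < j + r ∧ j + r < k + r) ∨
      (k + r < i + r ∧ i + r < j + r) ∨ (j + r < k + r ∧ k + r < i + r) := by decide
  intro i j k hij hjk
  rcases key r i j k hij hjk with h | h | h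
  · exact hq h.1 h.2
  · exact cross_rotate (q (k + r)) _ _ ▸ hq h.1 h.2
  · rw [← cross_rotate]; exact hq h.1 h.2

/-- Among the quadrilaterals omitting two vertices at distance two, one has at least two thirds
of the area of the hexagon. -/
lemma exists_large_quadrilateral {q : Fin 6 → ℝ × ℝ} (hq : IsCounterclockwise q) :
    ∃ i j k l : Fin 6, i < j ∧ j < k ∧ k < l ∧
      2 / 3 * (cross (q 0) (q 1) (q 2) + cross (q 0) (q 2) (q 3) + cross (q 0) (q 3) (q 4) +
        cross (q 0) (q 4) (q 5)) ≤ cross (q i) (q j) (q k) + cross (q i) (q k) (q l) := by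
  by_contra! hcon
  have pos (i j k : Fin 6) (hij : i < j := by decide) (hjk : j < k := by decide) :
      0 < cross (q i) (q j) (q k) := hq hij hjk
  have small (i j k l : Fin 6) (hij : i < j := by decide) (hjk : j < k := by decide)
    (hkl : k < l := by decide) := hcon i j k l hij hjk hkl
  obtain ⟨s, t, hs0, hs1, ht0, ht1, hx⟩ :=
    exists_diagonal_inter (pos 0 1 3) (pos 0 1 4) (pos 0 3 4) (pos 1 3 4)
  have h₀ := small 1 3 4 5
  have h₁ := small 0 2 4 5
  have h₂ := small 0 1 3 5
  have h₃ := small 0 1 2 4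
  have h₄ := small 1 2 3 5
  have h₅ := small 0 2 3 4
  rcases le_total (cross (q 2) (q 5) (q 0 + s • (q 3 - q 0))) 0 with hside | hside
  · refine false_of_large_ears_of_side hq rfl rfl rfl rfl rfl rfl rfl hs0 hs1 ht0 ht1 rfl hx hside
      ?_ ?_ ?_ ?_ ?_ ?_ <;> (unfold cross at *; linarith)
  · refine false_of_large_ears_of_side (hq.rotate 3) (a := q 3) (b := q 4) (c := q 5) (d := q 0)
      (e := q 1) (f := q 2) (x := q 0 + s • (q 3 - q 0)) (s := 1 - s) (t := 1 - t)
      rfl rfl rfl rfl rfl rfl rfl (by linarith) (by linarith) (by linarith) (by linarith)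
      (by module) (by rw [hx]; module) ?_ ?_ ?_ ?_ ?_ ?_ ?_ <;> (unfold cross at *; linarith)

lemma convexHull_triangle {a b c : ℝ × ℝ} (h : 0 < cross a b c) :
    convexHull ℝ {a, b, c} = {z | 0 ≤ cross a b z ∧ 0 ≤ cross b c z ∧ 0 ≤ cross c a z} := by
  have e₁ : cross b c a = cross a b c := cross_rotate a b c
  have e₂ : cross c a b = cross a b c := by rw [← cross_rotate]
  have zero₁ (x y : ℝ × ℝ) : cross x y x = 0 := by unfold cross; ring
  have zero₂ (x y : ℝ × ℝ) : cross x y y = 0 := by unfold cross; ring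
  refine Set.Subset.antisymm (convexHull_min ?_ ?_) fun z hz ↦
    mem_convexHull_triangle h hz.1 hz.2.1 hz.2.2
  · rintro z (rfl | rfl | rfl) <;> simp [e₁, e₂, zero₁, zero₂, h.le]
  · exact (convex_cross_nonneg a b).inter ((convex_cross_nonneg b c).inter
      (convex_cross_nonneg c a))

lemma volume_standard_triangle :
    volume {z : ℝ × ℝ | 0 ≤ z.1 ∧ 0 ≤ z.2 ∧ z.1 + z.2 ≤ 1} = ENNReal.ofReal (1 / 2) := by
  have hmeas : MeasurableSet {z : ℝ × ℝ | 0 ≤ z.1 ∧ 0 ≤ z.2 ∧ z.1 + z.2 ≤ 1} :=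
    (measurableSet_le measurable_const measurable_fst).inter
      ((measurableSet_le measurable_const measurable_snd).inter
        (measurableSet_le (measurable_fst.add measurable_snd) measurable_const))
  have hsec (x : ℝ) : volume (Prod.mk x ⁻¹' {z : ℝ × ℝ | 0 ≤ z.1 ∧ 0 ≤ z.2 ∧ z.1 + z.2 ≤ 1})
      = (Set.Icc 0 1).indicator (fun x ↦ ENNReal.ofReal (1 - x)) x := by
    by_cases hx : x ∈ Set.Icc (0 : ℝ) 1
    · have : Prod.mk x ⁻¹' {z : ℝ × ℝ | 0 ≤ z.1 ∧ 0 ≤ z.2 ∧ z.1 + z.2 ≤ 1}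
          = Set.Icc 0 (1 - x) := by
        ext y
        simp only [Set.mem_preimage, Set.mem_ofPred_eq, Set.mem_Icc, le_sub_iff_add_le']
        exact ⟨fun h ↦ h.2, fun h ↦ ⟨hx.1, h⟩⟩
      rw [this, Set.indicator_of_mem hx, Real.volume_Icc, sub_zero]
    · have : Prod.mk x ⁻¹' {z : ℝ × ℝ | 0 ≤ z.1 ∧ 0 ≤ z.2 ∧ z.1 + z.2 ≤ 1} = ∅ := by
        ext y
        simp only [Set.mem_preimage, Set.mem_ofPred_eq, Set.mem_empty_iff_false, iff_false]
        rintro ⟨h₁, h₂, h₃⟩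
        exact hx ⟨h₁, by linarith⟩
      rw [this, Set.indicator_of_notMem hx, measure_empty]
  rw [Measure.volume_eq_prod, Measure.prod_apply hmeas, lintegral_congr hsec,
    lintegral_indicator measurableSet_Icc,
    ← ofReal_integral_eq_lintegral_ofReal (Continuous.integrableOn_Icc (by fun_prop))]
  · rw [integral_Icc_eq_integral_Ioc, ← intervalIntegral.integral_of_le zero_le_one]
    rw [intervalIntegral.integral_sub (by simp) (by simp), integral_id]
    norm_num
  · filter_upwards [ae_restrict_mem measurableSet_Icc] with x hx using sub_nonneg.2 hx.2

lemma volume_convexHull_triangle {a b c : ℝ × ℝ} (h : 0 < cross a b c) :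
    volume (convexHull ℝ {a, b, c}) = ENNReal.ofReal (cross a b c / 2) := by
  set L : ℝ × ℝ →ₗ[ℝ] ℝ × ℝ := Matrix.toLin (Module.Basis.finTwoProd ℝ) (Module.Basis.finTwoProd ℝ)
    !![b.1 - a.1, c.1 - a.1; b.2 - a.2, c.2 - a.2] with hL
  have hdet : LinearMap.det L = cross a b c := by
    rw [hL, LinearMap.det_toLin, Matrix.det_fin_two_of]
    unfold cross; ring
  have himg : (fun z ↦ a + z) ⁻¹' convexHull ℝ {a, b, c}
      = L '' {z : ℝ × ℝ | 0 ≤ z.1 ∧ 0 ≤ z.2 ∧ z.1 + z.2 ≤ 1} := by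
    rw [convexHull_triangle h]
    ext z
    simp only [Set.mem_preimage, Set.mem_ofPred_eq, Set.mem_image]
    constructor
    · rintro ⟨h₁, h₂, h₃⟩
      refine ⟨(cross c a (a + z) / cross a b c, cross a b (a + z) / cross a b c),
        ⟨by positivity, by positivity, ?_⟩, ?_⟩
      · rw [← add_div, div_le_one h]
        have : cross a b c = cross a b (a + z) + cross b c (a + z) + cross c a (a + z) := by
          unfold cross; ring
        linarith
      · rw [hL, Matrix.toLin_finTwoProd_apply]
        ext
        · simp only
          field_simp
          simp [cross]; ring
        · simp only
          field_simp
          simp [cross]; ring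
    · rintro ⟨w, ⟨h₁, h₂, h₃⟩, rfl⟩
      rw [hL, Matrix.toLin_finTwoProd_apply]
      have k₁ := mul_nonneg h₁ h.le
      have k₂ := mul_nonneg h₂ h.le
      have k₃ := mul_nonneg (sub_nonneg.2 h₃) h.le
      simp only [cross, Prod.fst_add, Prod.snd_add] at k₁ k₂ k₃ ⊢
      refine ⟨?_, ?_, ?_⟩ <;> linarith
  rw [← measure_preimage_add volume a, himg, Measure.addHaar_image_linearMap, hdet,
    volume_standard_triangle, abs_of_pos h, ← ENNReal.ofReal_mul h.le]
  congr 1; ring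

lemma volume_line_eq_zero {a c d : ℝ × ℝ} (h : cross a c d ≠ 0) :
    volume {z | cross a c z = 0} = 0 := by
  set φ : ℝ × ℝ →ₗ[ℝ] ℝ :=
    (c.1 - a.1) • LinearMap.snd ℝ ℝ ℝ - (c.2 - a.2) • LinearMap.fst ℝ ℝ ℝ with hφ
  have hker : LinearMap.ker φ ≠ ⊤ := by
    intro htop
    have : d - a ∈ LinearMap.ker φ := htop ▸ Submodule.mem_top
    exact h (by simpa [hφ, cross] using this)
  have : (fun z ↦ a + z) ⁻¹' {z | cross a c z = 0} = LinearMap.ker φ := by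
    ext z
    simp [hφ, cross]
  rw [← measure_preimage_add volume a, this]
  exact Measure.addHaar_submodule _ _ hker

lemma volume_convexHull_ne_top {S : Set (ℝ × ℝ)} (hS : S.Finite) :
    volume (convexHull ℝ S) ≠ ⊤ :=
  (hS.isCompact_convexHull (𝕜 := ℝ)).measure_lt_top.ne

lemma add_le_area_quadrilateral {a b c d : ℝ × ℝ} (habc : 0 < cross a b c)
    (hacd : 0 < cross a c d) :
    (cross a b c + cross a c d) / 2 ≤ area {a, b, c, d} := by
  have hdisj : AEDisjoint volume (convexHull ℝ {a, b, c}) (convexHull ℝ {a, c, d}) := by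
    refine measure_mono_null ?_ (volume_line_eq_zero hacd.ne')
    rw [convexHull_triangle habc, convexHull_triangle hacd]
    rintro z ⟨⟨-, -, h₁⟩, ⟨h₂, -, -⟩⟩
    have : cross c a z = -cross a c z := by unfold cross; ring
    exact le_antisymm (by linarith) h₂
  have hmeas : NullMeasurableSet (convexHull ℝ {a, c, d}) volume :=
    ((Set.toFinite {a, c, d}).isCompact_convexHull (𝕜 := ℝ)).measurableSet.nullMeasurableSet
  have hsub : convexHull ℝ {a, b, c} ∪ convexHull ℝ {a, c, d} ⊆ convexHull ℝ {a, b, c, d} :=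
    Set.union_subset (convexHull_mono (by grind)) (convexHull_mono (by grind))
  have hle := measure_mono (μ := volume) hsub
  rw [measure_union₀ hmeas hdisj, volume_convexHull_triangle habc, volume_convexHull_triangle hacd,
    ← ENNReal.ofReal_add (by positivity) (by positivity), ← add_div] at hle
  exact (ENNReal.ofReal_le_iff_le_toReal (volume_convexHull_ne_top (Set.toFinite _))).1 hle

lemma IsCounterclockwise.area_hexagon_le {q : Fin 6 → ℝ × ℝ} (hq : IsCounterclockwise q) :
    area (Set.range q) ≤ (cross (q 0) (q 1) (q 2) + cross (q 0) (q 2) (q 3) +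
      cross (q 0) (q 3) (q 4) + cross (q 0) (q 4) (q 5)) / 2 := by
  have pos (i j k : Fin 6) (hij : i < j := by decide) (hjk : j < k := by decide) :
      0 < cross (q i) (q j) (q k) := hq hij hjk
  have hedge (i : Fin 6) : convexHull ℝ (Set.range q) ⊆ {z | 0 ≤ cross (q i) (q (i + 1)) z} := by
    refine convexHull_min ?_ (convex_cross_nonneg _ _)
    rintro _ ⟨j, rfl⟩
    have key : ∀ i j : Fin 6, j = i ∨ j = i + 1 ∨ (i < i + 1 ∧ i + 1 < j) ∨
      (i + 1 < j ∧ j < i) ∨ (j < i ∧ i < i + 1) := by decide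
    rcases key i j with rfl | rfl | h | h | h
    · simp [cross]
    · simp [cross, mul_comm]
    · exact (hq h.1 h.2).le
    · exact (cross_rotate (q i) (q (i + 1)) (q j) ▸ hq h.1 h.2).le
    · exact (cross_rotate (q j) (q i) (q (i + 1)) ▸ hq h.1 h.2).le
  have hcover : convexHull ℝ (Set.range q) ⊆
      ((convexHull ℝ {q 0, q 1, q 2} ∪ convexHull ℝ {q 0, q 2, q 3}) ∪
        convexHull ℝ {q 0, q 3, q 4}) ∪ convexHull ℝ {q 0, q 4, q 5} := by
    intro z hz
    rw [convexHull_triangle (pos 0 1 2), convexHull_triangle (pos 0 2 3),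
      convexHull_triangle (pos 0 3 4), convexHull_triangle (pos 0 4 5)]
    have g₀ : 0 ≤ cross (q 0) (q 1) z := hedge 0 hz
    have g₁ : 0 ≤ cross (q 1) (q 2) z := hedge 1 hz
    have g₂ : 0 ≤ cross (q 2) (q 3) z := hedge 2 hz
    have g₃ : 0 ≤ cross (q 3) (q 4) z := hedge 3 hz
    have g₄ : 0 ≤ cross (q 4) (q 5) z := hedge 4 hz
    have g₅ : 0 ≤ cross (q 5) (q 0) z := hedge 5 hz
    have hneg (i : Fin 6) : cross (q i) (q 0) z = -cross (q 0) (q i) z := by unfold cross; ring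
    simp only [Set.mem_union, Set.mem_ofPred_eq, hneg, Left.nonneg_neg_iff] at g₅ ⊢
    rcases le_total (cross (q 0) (q 2) z) 0 with h₂ | h₂
    · tauto
    rcases le_total (cross (q 0) (q 3) z) 0 with h₃ | h₃
    · tauto
    rcases le_total (cross (q 0) (q 4) z) 0 with h₄ | h₄ <;> tauto
  have p₁ := pos 0 1 2
  have p₂ := pos 0 2 3
  have p₃ := pos 0 3 4
  have p₄ := pos 0 4 5
  refine ENNReal.toReal_le_of_le_ofReal (by positivity) ((measure_mono hcover).trans ?_)
  rw [add_div, add_div, add_div, ENNReal.ofReal_add (by positivity) (by positivity),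
    ENNReal.ofReal_add (by positivity) (by positivity),
    ENNReal.ofReal_add (by positivity) (by positivity), ← volume_convexHull_triangle p₁,
    ← volume_convexHull_triangle p₂, ← volume_convexHull_triangle p₃,
    ← volume_convexHull_triangle p₄]
  refine (measure_union_le _ _).trans ?_
  gcongr
  refine (measure_union_le _ _).trans ?_
  gcongr
  exact measure_union_le _ _

lemma collinear_of_cross_eq_zero {a b c : ℝ × ℝ} (h : cross a b c = 0) :
    Collinear ℝ {a, b, c} := by
  by_cases hab : a = b
  · simpa [hab] using collinear_pair ℝ b c
  have hpos : 0 < (b.1 - a.1) ^ 2 + (b.2 - a.2) ^ 2 := by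
    by_contra! hcon
    exact hab (Prod.ext (by nlinarith [sq_nonneg (b.1 - a.1), sq_nonneg (b.2 - a.2)])
      (by nlinarith [sq_nonneg (b.1 - a.1), sq_nonneg (b.2 - a.2)]))
  rw [collinear_iff_of_mem (p₀ := a) (by simp)]
  refine ⟨b - a, ?_⟩
  rintro z (rfl | rfl | rfl)
  · exact ⟨0, by simp⟩
  · exact ⟨1, by simp⟩
  · refine ⟨((b.1 - a.1) * (z.1 - a.1) + (b.2 - a.2) * (z.2 - a.2)) /
      ((b.1 - a.1) ^ 2 + (b.2 - a.2) ^ 2), ?_⟩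
    unfold cross at h
    ext
    · simp
      field_simp
      linear_combination -(b.2 - a.2) * h
    · simp
      field_simp
      linear_combination (b.1 - a.1) * h

section Ordering

variable {n : ℕ} {p : Fin n → ℝ × ℝ}

lemma StrictConvexPos.notMem_convexHull (hp : StrictConvexPos p) {i : Fin n} {S : Set (ℝ × ℝ)}
    (hS : S ⊆ p '' {j | j ≠ i}) : p i ∉ convexHull ℝ S :=
  fun h ↦ hp.1 i (convexHull_mono hS h)

lemma StrictConvexPos.cross_ne_zero (hp : StrictConvexPos p) {i j k : Fin n} (hij : i ≠ j)
    (hjk : j ≠ k) (hik : i ≠ k) : cross (p i) (p j) (p k) ≠ 0 := by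
  intro h
  have hpair {i j k : Fin n} (hji : j ≠ i) (hki : k ≠ i) : ¬Wbtw ℝ (p j) (p i) (p k) := by
    rw [← mem_segment_iff_wbtw, ← convexHull_pair]
    refine hp.notMem_convexHull ?_
    rintro _ (rfl | rfl)
    exacts [⟨j, hji, rfl⟩, ⟨k, hki, rfl⟩]
  rcases (collinear_of_cross_eq_zero h).wbtw_or_wbtw_or_wbtw with h | h | h
  · exact hpair hij hjk.symm h
  · exact hpair hjk hik h
  · exact hpair hik.symm hij.symm h

lemma StrictConvexPos.not_cross_nonneg (hp : StrictConvexPos p) {i j k l : Fin n} (hji : j ≠ i)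
    (hki : k ≠ i) (hli : l ≠ i) (h : 0 < cross (p j) (p k) (p l))
    (hjk : 0 ≤ cross (p j) (p k) (p i)) (hkl : 0 ≤ cross (p k) (p l) (p i))
    (hlj : 0 ≤ cross (p l) (p j) (p i)) : False := by
  refine hp.notMem_convexHull ?_ (mem_convexHull_triangle h hjk hkl hlj)
  rintro _ (rfl | rfl | rfl)
  exacts [⟨j, hji, rfl⟩, ⟨k, hki, rfl⟩, ⟨l, hli, rfl⟩]

end Ordering

lemma StrictConvexPos.exists_isCounterclockwise {n : ℕ} {p : Fin (n + 1) → ℝ × ℝ}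
    (hp : StrictConvexPos p) :
    ∃ σ : Equiv.Perm (Fin (n + 1)), IsCounterclockwise (p ∘ σ) := by
  classical
  let r (i j : Fin n) : Prop := 0 < cross (p 0) (p i.succ) (p j.succ)
  have hirr (i : Fin n) : ¬r i i := by
    simp only [r, not_lt]
    exact le_of_eq (by unfold cross; ring)
  have hconn {i j : Fin n} (hij : i ≠ j) (h : ¬r j i) : r i j := by
    have hne := hp.cross_ne_zero (i := 0) (j := i.succ) (k := j.succ) (Fin.succ_ne_zero _).symm
      (by simpa using hij) (Fin.succ_ne_zero _).symm
    have := cross_swap (p 0) (p j.succ) (p i.succ)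
    simp only [r, not_lt] at h ⊢
    exact lt_of_le_of_ne (by linarith) hne.symm
  have hasymm {i j : Fin n} (hij : r i j) : ¬r j i := by
    simp only [r] at hij ⊢
    rw [cross_swap]; linarith
  have htrans {i j k : Fin n} (hij : r i j) (hjk : r j k) : r i k := by
    by_contra hik
    have hne : k ≠ i := by
      rintro rfl
      exact hasymm hij hjk
    have hki : r k i := hconn hne hik
    simp only [r] at hij hjk hki
    refine hp.not_cross_nonneg (i := 0) (Fin.succ_ne_zero i) (Fin.succ_ne_zero j)
      (Fin.succ_ne_zero k) ?_ (by rw [cross_rotate]; exact hij.le)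
      (by rw [cross_rotate]; exact hjk.le) (by rw [cross_rotate]; exact hki.le)
    have : cross (p i.succ) (p j.succ) (p k.succ) = cross (p 0) (p i.succ) (p j.succ) +
        cross (p 0) (p j.succ) (p k.succ) + cross (p 0) (p k.succ) (p i.succ) := by
      unfold cross; ring
    linarith
  let key (i : Fin n) : ℕ := (Finset.univ.filter fun j ↦ r j i).card
  have hkey {i j : Fin n} (h : r i j) : key i < key j := by
    refine Finset.card_lt_card
      (Finset.ssubset_iff_of_subset ?_ |>.2 ⟨i, by simpa, by simpa using hirr i⟩)
    intro k hk
    simp only [Finset.mem_filter, Finset.mem_univ, true_and] at hk ⊢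
    exact htrans hk h
  let τ := Tuple.sort key
  have hτ {i j : Fin n} (hij : i < j) : r (τ i) (τ j) :=
    hconn (by simpa using hij.ne) fun h ↦ (hkey h).not_ge (Tuple.monotone_sort key hij.le)
  let f : Fin (n + 1) → Fin (n + 1) := Fin.cons 0 fun i ↦ (τ i).succ
  have hf : Function.Injective f := by
    rw [Fin.cons_injective_iff]
    refine ⟨?_, (Fin.succ_injective n).comp τ.injective⟩
    rintro ⟨i, hi⟩
    exact Fin.succ_ne_zero _ hi
  let σ := Equiv.ofBijective f (Finite.injective_iff_bijective.1 hf)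
  have h0 : σ 0 = 0 := rfl
  have hs (i : Fin n) : σ i.succ = (τ i).succ := rfl
  refine ⟨σ, fun i j k hij hjk ↦ ?_⟩
  obtain ⟨k, rfl⟩ := Fin.exists_succ_eq.2 (Fin.ne_zero_of_lt hjk)
  obtain ⟨j, rfl⟩ := Fin.exists_succ_eq.2 (Fin.ne_zero_of_lt hij)
  have hjk' : r (τ j) (τ k) := hτ (by simpa using hjk)
  rcases Fin.eq_zero_or_eq_succ i with rfl | ⟨i, rfl⟩
  · simpa [h0, hs] using hjk'
  have hij' : r (τ i) (τ j) := hτ (by simpa using hij)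
  have hik' : r (τ i) (τ k) := htrans hij' hjk'
  have hij₀ : i ≠ j := by rintro rfl; exact lt_irrefl _ hij
  have hjk₀ : j ≠ k := by rintro rfl; exact lt_irrefl _ hjk
  simp only [Function.comp_apply, hs]
  by_contra! hcon
  simp only [r] at hij' hjk' hik'
  refine hp.not_cross_nonneg (i := (τ j).succ) (j := 0) (k := (τ i).succ) (l := (τ k).succ)
    (Fin.succ_ne_zero _).symm (by simpa using hij₀) (by simpa using hjk₀.symm) hik' hij'.le
    (by rw [cross_swap]; linarith) ?_
  rw [← cross_rotate]; exact hjk'.le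

/-- Every convex hexagon contains a quadrilateral on four of its vertices whose
area is at least `2/3` of the area of the hexagon. -/
theorem hexagon_contains_large_quadrilateral
    (p : Fin 6 → ℝ × ℝ) (hp : StrictConvexPos p) :
    ∃ s : Finset (Fin 6), s.card = 4 ∧
      (2 / 3) * area (Set.range p) ≤ area (p '' ↑s) := by
  obtain ⟨σ, hσ⟩ := hp.exists_isCounterclockwise
  obtain ⟨i, j, k, l, hij, hjk, hkl, hlarge⟩ := exists_large_quadrilateral hσ
  have hhex := hσ.area_hexagon_le
  have hquad := add_le_area_quadrilateral (hσ hij hjk) (hσ (hij.trans hjk) hkl)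
  rw [σ.surjective.range_comp] at hhex
  refine ⟨({i, j, k, l} : Finset (Fin 6)).map σ.toEmbedding, ?_, ?_⟩
  · rw [Finset.card_map]
    grind
  · have : p '' ↑(({i, j, k, l} : Finset (Fin 6)).map σ.toEmbedding)
        = {(p ∘ σ) i, (p ∘ σ) j, (p ∘ σ) k, (p ∘ σ) l} := by
      simp [Set.image_insert_eq]
    rw [this]
    linarith
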